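/- Let d ≥ 1, and let h : ℝ^d → ℝ with ⟨|∇h(x)|⁴⟩^{1/4} ≤ K |x|^{-d} for all |x| > 2R (pointwise fourth-moment bound with far-field decay) and (∫ ⟨|∇h|⁴⟩^{1/2} dx)^{1/2} ≤ K'. Given a kernel |c(z)| ≤ C₀(1+|z|)^{-(d+α)}, α ∈ (0, d/2], the splitting of ∫∫ ⟨|∇h(x)|⁴⟩^{1/4} |c(x-y)| ⟨|∇h'(y)|⁴⟩^{1/4} dy dx over the four regions (B_{3R} or B_{3R}^c) × (B_{3R}(Le) or B_{3R}(Le)^c), with ∇h' satisfying the translated analogues centered at Le, yields the bound C · R^{-d/2} L^{-d/2-α} log(L/R), provided L ≥ 4R, K ≤ R^{-d/2}·R^{d/2}·stuff normalized so K corresponds to R^{-d/2}-scaling and K' ≤ R^{-d}. -/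

import Mathlib

open MeasureTheory Metric Module Set
open scoped ENNReal

section Radial

variable {E : Type*} [NormedAddCommGroup E] [NormedSpace ℝ E] [FiniteDimensional ℝ E]
  [Nontrivial E] [MeasurableSpace E] [BorelSpace E] (μ : Measure E) [μ.IsAddHaarMeasure]

lemma setLIntegral_fun_norm_sub_addHaar {S : Set ℝ} (hS : MeasurableSet S) (hS0 : S ⊆ Ioi 0)
    {g : ℝ → ℝ} (hg : ∀ r ∈ S, 0 ≤ g r)
    (hint : IntegrableOn (fun r => r ^ (finrank ℝ E - 1) * g r) S) (z : E) :
    ∫⁻ x in {x | ‖x - z‖ ∈ S}, ENNReal.ofReal (g ‖x - z‖) ∂μ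
      = ENNReal.ofReal (finrank ℝ E * μ.real (ball 0 1) *
          ∫ r in S, r ^ (finrank ℝ E - 1) * g r) := by
  have hmeas : MeasurableSet {x : E | ‖x - z‖ ∈ S} := by
    have : Measurable fun x : E => ‖x - z‖ := by fun_prop
    exact this hS
  have hind : ∀ x : E, ({x | ‖x - z‖ ∈ S}.indicator fun x => ENNReal.ofReal (g ‖x - z‖)) x
      = ENNReal.ofReal (S.indicator g ‖x - z‖) := by
    intro x
    by_cases hx : ‖x - z‖ ∈ S
    · simp [hx]
    · simp [hx]
  have hmul : (fun r => r ^ (finrank ℝ E - 1) • S.indicator g r)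
      = S.indicator fun r => r ^ (finrank ℝ E - 1) * g r := by
    ext r
    by_cases hr : r ∈ S <;> simp [hr]
  rw [← lintegral_indicator hmeas, lintegral_congr hind,
    lintegral_sub_right_eq_self (fun x => ENNReal.ofReal (S.indicator g ‖x‖)) z,
    ← ofReal_integral_eq_lintegral_ofReal]
  · rw [integral_fun_norm_addHaar μ (S.indicator g), hmul, setIntegral_indicator hS,
      inter_eq_self_of_subset_right hS0]
    simp [mul_assoc]
  · rw [integrable_fun_norm_addHaar μ (f := S.indicator g), hmul]
    exact ((integrable_indicator_iff hS).2 hint).integrableOn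
  · exact Filter.Eventually.of_forall fun x => indicator_nonneg hg _

lemma setLIntegral_annulus_norm_rpow_neg_finrank {a b : ℝ} (ha : 0 < a) (hab : a ≤ b) (z : E) :
    ∫⁻ x in closedBall z b \ closedBall z a,
        ENNReal.ofReal (‖x - z‖ ^ (-(finrank ℝ E : ℝ))) ∂μ
      = ENNReal.ofReal (finrank ℝ E * μ.real (ball 0 1) * Real.log (b / a)) := by
  have hpos : 0 < finrank ℝ E := finrank_pos
  have hset : closedBall z b \ closedBall z a = {x : E | ‖x - z‖ ∈ Ioc a b} := by
    ext x
    simp [dist_eq_norm, and_comm]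
  have heq : EqOn (fun r : ℝ => r ^ (finrank ℝ E - 1) * r ^ (-(finrank ℝ E : ℝ)))
      (fun r => r⁻¹) (Ioc a b) := by
    intro r hr
    have hr0 : 0 < r := ha.trans hr.1
    simp only
    rw [← Real.rpow_natCast, ← Real.rpow_add hr0, ← Real.rpow_neg_one]
    congr 1
    push_cast [Nat.cast_sub hpos]
    ring
  have hint : IntegrableOn (fun r : ℝ => r⁻¹) (Ioc a b) := by
    rw [← intervalIntegrable_iff_integrableOn_Ioc_of_le hab]
    exact intervalIntegrable_inv_iff.2
      (Or.inr (by rw [uIcc_of_le hab]; exact fun h => absurd h.1 (not_le.2 ha)))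
  rw [hset, setLIntegral_fun_norm_sub_addHaar μ measurableSet_Ioc
    (fun r hr => ha.trans hr.1) (fun r hr => Real.rpow_nonneg (ha.trans hr.1).le _)
    (hint.congr_fun heq.symm measurableSet_Ioc), setIntegral_congr_fun measurableSet_Ioc heq,
    ← intervalIntegral.integral_of_le hab, integral_inv_of_pos ha (ha.trans_le hab)]

lemma setLIntegral_compl_closedBall_norm_rpow_neg_two_mul_finrank {a : ℝ} (ha : 0 < a) (z : E) :
    ∫⁻ x in (closedBall z a)ᶜ, ENNReal.ofReal (‖x - z‖ ^ (-(2 * finrank ℝ E : ℝ))) ∂μ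
      = ENNReal.ofReal (μ.real (ball 0 1) * a ^ (-(finrank ℝ E : ℝ))) := by
  have hpos : 0 < finrank ℝ E := finrank_pos
  have hpos' : (0 : ℝ) < finrank ℝ E := by exact_mod_cast hpos
  have hset : (closedBall z a)ᶜ = {x : E | ‖x - z‖ ∈ Ioi a} := by
    ext x
    simp [dist_eq_norm]
  have heq : EqOn (fun r : ℝ => r ^ (finrank ℝ E - 1) * r ^ (-(2 * finrank ℝ E : ℝ)))
      (fun r => r ^ (-(finrank ℝ E : ℝ) - 1)) (Ioi a) := by
    intro r hr
    have hr0 : 0 < r := ha.trans hr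
    simp only
    rw [← Real.rpow_natCast, ← Real.rpow_add hr0]
    congr 1
    push_cast [Nat.cast_sub hpos]
    ring
  have hlt : -(finrank ℝ E : ℝ) - 1 < -1 := by linarith
  rw [hset, setLIntegral_fun_norm_sub_addHaar μ measurableSet_Ioi
    (fun r hr => ha.trans hr) (fun r hr => Real.rpow_nonneg (ha.trans hr).le _)
    ((integrableOn_Ioi_rpow_of_lt hlt ha).congr_fun heq.symm measurableSet_Ioi),
    setIntegral_congr_fun measurableSet_Ioi heq, integral_Ioi_rpow_of_lt hlt ha]
  congr 1
  rw [sub_add_cancel]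
  field_simp

lemma setLIntegral_le_measure_rpow_mul {X : Type*} [MeasurableSpace X] (ν : Measure X)
    {F : X → ℝ≥0∞} (hF : Measurable F) (s : Set X) :
    ∫⁻ x in s, F x ∂ν ≤ ν s ^ (1 / 2 : ℝ) * (∫⁻ x, F x ^ (2 : ℝ) ∂ν) ^ (1 / 2 : ℝ) := by
  have h := ENNReal.lintegral_mul_le_Lp_mul_Lq (ν.restrict s) Real.HolderConjugate.two_two
    (f := fun _ => 1) aemeasurable_const hF.aemeasurable
  simp only [Pi.mul_apply, one_mul, ENNReal.one_rpow, lintegral_one,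
    Measure.restrict_apply_univ] at h
  refine h.trans ?_
  gcongr
  exact Measure.restrict_le_self

lemma setLIntegral_closedBall_le_of_decay {F : E → ℝ≥0∞} (hF : Measurable F) {K a b : ℝ}
    (hK : 0 ≤ K) (ha : 0 < a) (hab : a ≤ b) (z : E)
    (hdecay : ∀ x, a < ‖x - z‖ → F x ≤ ENNReal.ofReal (K * ‖x - z‖ ^ (-(finrank ℝ E : ℝ)))) :
    ∫⁻ x in closedBall z b, F x ∂μ
      ≤ μ (closedBall z a) ^ (1 / 2 : ℝ) * (∫⁻ x, F x ^ (2 : ℝ) ∂μ) ^ (1 / 2 : ℝ)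
        + ENNReal.ofReal (K * (finrank ℝ E * μ.real (ball 0 1) * Real.log (b / a))) := by
  rw [← sdiff_union_of_subset (closedBall_subset_closedBall (x := z) hab), union_comm]
  refine (lintegral_union_le _ _ _).trans (add_le_add ?_ ?_)
  · exact setLIntegral_le_measure_rpow_mul μ hF _
  · rw [ENNReal.ofReal_mul hK, ← setLIntegral_annulus_norm_rpow_neg_finrank μ ha hab z,
      ← lintegral_const_mul' _ _ ENNReal.ofReal_ne_top]
    refine setLIntegral_mono' (measurableSet_closedBall.diff measurableSet_closedBall) ?_
    intro x hx
    rw [← ENNReal.ofReal_mul hK]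
    exact hdecay x (by simpa [dist_eq_norm] using hx.2)

lemma setLIntegral_sq_compl_closedBall_le_of_decay {F : E → ℝ≥0∞} {K b : ℝ}
    (hK : 0 ≤ K) (hb : 0 < b) (z : E)
    (hdecay : ∀ x, b < ‖x - z‖ → F x ≤ ENNReal.ofReal (K * ‖x - z‖ ^ (-(finrank ℝ E : ℝ)))) :
    (∫⁻ x in (closedBall z b)ᶜ, F x ^ (2 : ℝ) ∂μ) ^ (1 / 2 : ℝ)
      ≤ ENNReal.ofReal (K * √(μ.real (ball 0 1)) * b ^ (-(finrank ℝ E : ℝ) / 2)) := by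
  have hle : ∫⁻ x in (closedBall z b)ᶜ, F x ^ (2 : ℝ) ∂μ
      ≤ ENNReal.ofReal (K ^ 2 * (μ.real (ball 0 1) * b ^ (-(finrank ℝ E : ℝ)))) := by
    rw [ENNReal.ofReal_mul (sq_nonneg K),
      ← setLIntegral_compl_closedBall_norm_rpow_neg_two_mul_finrank μ hb z,
      ← lintegral_const_mul' _ _ ENNReal.ofReal_ne_top]
    refine setLIntegral_mono' measurableSet_closedBall.compl fun x hx => ?_
    have hx' : b < ‖x - z‖ := by simpa [dist_eq_norm] using hx
    have hx0 : 0 ≤ ‖x - z‖ := norm_nonneg _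
    refine (ENNReal.rpow_le_rpow (hdecay x hx') zero_le_two).trans_eq ?_
    rw [ENNReal.ofReal_rpow_of_nonneg (by positivity) zero_le_two, ← ENNReal.ofReal_mul
      (sq_nonneg K), Real.mul_rpow hK (by positivity), ← Real.rpow_mul hx0, Real.rpow_two]
    congr 3
    ring
  refine (ENNReal.rpow_le_rpow hle (by norm_num)).trans_eq ?_
  rw [ENNReal.ofReal_rpow_of_nonneg (by positivity) (by norm_num), ← Real.sqrt_eq_rpow,
    Real.sqrt_mul (sq_nonneg K), Real.sqrt_sq hK, Real.sqrt_mul measureReal_nonneg,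
    Real.sqrt_eq_rpow (b ^ _), ← Real.rpow_mul hb.le, mul_assoc]
  congr 4
  ring

end Radial

section Bilinear

lemma lintegral_lintegral_mul_le_of_le {G : Type*} [Sub G] [MeasurableSpace G] (μ : Measure G)
    {f g k : G → ℝ≥0∞} (hf : Measurable f) (hg : Measurable g) {M : ℝ≥0∞}
    (hM : ∀ x y, f x * k (x - y) * g y ≤ M * (f x * g y)) :
    ∫⁻ x, ∫⁻ y, f x * k (x - y) * g y ∂μ ∂μ ≤ M * (∫⁻ x, f x ∂μ) * ∫⁻ y, g y ∂μ := by
  calc ∫⁻ x, ∫⁻ y, f x * k (x - y) * g y ∂μ ∂μ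
      ≤ ∫⁻ x, ∫⁻ y, M * f x * g y ∂μ ∂μ :=
        lintegral_mono fun x => lintegral_mono fun y => by simpa [mul_assoc] using hM x y
    _ = _ := by
        simp_rw [lintegral_const_mul _ hg]
        rw [lintegral_mul_const _ (hf.const_mul M), lintegral_const_mul _ hf]

variable {G : Type*} [AddCommGroup G] [MeasurableSpace G] [MeasurableAdd₂ G] [MeasurableNeg G]
  (μ : Measure G)
  {f g k : G → ℝ≥0∞}

lemma lintegral_lintegral_mul_le_of_le_right [μ.IsAddLeftInvariant] [μ.IsNegInvariant]
    (hf : Measurable f) (hk : Measurable k)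
    {M : ℝ≥0∞} (hM : ∀ y, g y ≤ M) :
    ∫⁻ x, ∫⁻ y, f x * k (x - y) * g y ∂μ ∂μ ≤ M * (∫⁻ z, k z ∂μ) * ∫⁻ x, f x ∂μ := by
  calc ∫⁻ x, ∫⁻ y, f x * k (x - y) * g y ∂μ ∂μ
      ≤ ∫⁻ x, ∫⁻ y, M * f x * k (x - y) ∂μ ∂μ := by
        refine lintegral_mono fun x => lintegral_mono fun y => ?_
        calc f x * k (x - y) * g y ≤ f x * k (x - y) * M := by gcongr; exact hM y
          _ = M * f x * k (x - y) := by ring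
    _ = _ := by
        have (x : G) : ∫⁻ y, M * f x * k (x - y) ∂μ = M * (∫⁻ z, k z ∂μ) * f x := by
          rw [lintegral_const_mul _ (by fun_prop),
            lintegral_sub_left_eq_self k x]
          ring
        simp_rw [this]
        rw [lintegral_const_mul _ hf]

lemma lintegral_lintegral_mul_le_of_le_left [SFinite μ] [μ.IsAddLeftInvariant] [μ.IsAddRightInvariant]
    [μ.IsNegInvariant] (hf : Measurable f) (hk : Measurable k)
    (hg : Measurable g) {M : ℝ≥0∞} (hM : ∀ x, f x ≤ M) :
    ∫⁻ x, ∫⁻ y, f x * k (x - y) * g y ∂μ ∂μ ≤ M * (∫⁻ z, k z ∂μ) * ∫⁻ y, g y ∂μ := by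
  rw [lintegral_lintegral_swap (by fun_prop)]
  have h := lintegral_lintegral_mul_le_of_le_right μ (k := fun z => k (-z)) hg
    (hk.comp measurable_neg) hM
  rw [lintegral_neg_eq_self] at h
  refine le_trans (le_of_eq ?_) h
  refine lintegral_congr fun x => lintegral_congr fun y => ?_
  rw [neg_sub]
  ring

lemma lintegral_lintegral_mul_le_L2 [SFinite μ] [μ.IsAddLeftInvariant] [μ.IsAddRightInvariant]
    [μ.IsNegInvariant] (hf : Measurable f) (hk : Measurable k) (hg : Measurable g) :
    ∫⁻ x, ∫⁻ y, f x * k (x - y) * g y ∂μ ∂μ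
      ≤ (∫⁻ z, k z ∂μ) * ((∫⁻ x, f x ^ (2 : ℝ) ∂μ) ^ (1 / 2 : ℝ)
          * (∫⁻ y, g y ^ (2 : ℝ) ∂μ) ^ (1 / 2 : ℝ)) := by
  calc ∫⁻ x, ∫⁻ y, f x * k (x - y) * g y ∂μ ∂μ
      = ∫⁻ x, ∫⁻ z, f x * k z * g (x - z) ∂μ ∂μ := by
        refine lintegral_congr fun x => ?_
        rw [← lintegral_sub_left_eq_self _ x]
        simp
    _ = ∫⁻ z, k z * ∫⁻ x, f x * g (x - z) ∂μ ∂μ := by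
        rw [lintegral_lintegral_swap (by fun_prop)]
        refine lintegral_congr fun z => ?_
        rw [← lintegral_const_mul _ (by fun_prop)]
        refine lintegral_congr fun x => ?_
        ring
    _ ≤ ∫⁻ z, k z * ((∫⁻ x, f x ^ (2 : ℝ) ∂μ) ^ (1 / 2 : ℝ)
          * (∫⁻ y, g y ^ (2 : ℝ) ∂μ) ^ (1 / 2 : ℝ)) ∂μ := by
        gcongr with z
        refine (ENNReal.lintegral_mul_le_Lp_mul_Lq μ Real.HolderConjugate.two_two
          hf.aemeasurable (g := fun x => g (x - z)) (by fun_prop)).trans_eq ?_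
        rw [lintegral_sub_right_eq_self (fun x => g x ^ (2 : ℝ)) z]
    _ = _ := lintegral_mul_const _ hk

lemma lintegral_lintegral_eq_add_indicator [SFinite μ] (hf : Measurable f) (hk : Measurable k)
    (hg : Measurable g) {s t : Set G} (hs : MeasurableSet s) (ht : MeasurableSet t) :
    ∫⁻ x, ∫⁻ y, f x * k (x - y) * g y ∂μ ∂μ
      = (∫⁻ x, ∫⁻ y, s.indicator f x * k (x - y) * t.indicator g y ∂μ ∂μ
          + ∫⁻ x, ∫⁻ y, s.indicator f x * k (x - y) * tᶜ.indicator g y ∂μ ∂μ)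
        + (∫⁻ x, ∫⁻ y, sᶜ.indicator f x * k (x - y) * t.indicator g y ∂μ ∂μ
          + ∫⁻ x, ∫⁻ y, sᶜ.indicator f x * k (x - y) * tᶜ.indicator g y ∂μ ∂μ) := by
  have key {u v : G → ℝ≥0∞} (hu : Measurable u) (hv : Measurable v) :
      Measurable fun p : G × G => u p.1 * k (p.1 - p.2) * v p.2 := by fun_prop
  have key' {u v : G → ℝ≥0∞} (hv : Measurable v) (x : G) :
      Measurable fun y => u x * k (x - y) * v y := by fun_prop
  have hs1 := hf.indicator hs
  have ht1 := hg.indicator ht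
  have split {u : G → ℝ≥0∞} (hu : Measurable u) :
      ∫⁻ x, ∫⁻ y, u x * k (x - y) * g y ∂μ ∂μ
        = ∫⁻ x, ∫⁻ y, u x * k (x - y) * t.indicator g y ∂μ ∂μ
          + ∫⁻ x, ∫⁻ y, u x * k (x - y) * tᶜ.indicator g y ∂μ ∂μ := by
    rw [← lintegral_add_left (key hu ht1).lintegral_prod_right']
    refine lintegral_congr fun x => ?_
    rw [← lintegral_add_left (key' ht1 x)]
    refine lintegral_congr fun y => ?_
    rw [← mul_add, ← Pi.add_apply (t.indicator g), indicator_self_add_compl]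
  rw [← split hs1, ← split (hf.indicator hs.compl),
    ← lintegral_add_left (key hs1 hg).lintegral_prod_right']
  refine lintegral_congr fun x => ?_
  rw [← lintegral_add_left (key' hg x)]
  refine lintegral_congr fun y => ?_
  rw [← add_mul, ← add_mul, ← Pi.add_apply (s.indicator f), indicator_self_add_compl]

end Bilinear

lemma lintegral_lintegral_mul_le_of_near_far {G : Type*} [AddCommGroup G] [MeasurableSpace G]
    [MeasurableAdd₂ G] [MeasurableNeg G] (μ : Measure G) [SFinite μ] [μ.IsAddLeftInvariant]
    [μ.IsAddRightInvariant] [μ.IsNegInvariant] {f g k : G → ℝ≥0∞} (hf : Measurable f)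
    (hk : Measurable k) (hg : Measurable g) {s t : Set G} (hs : MeasurableSet s)
    (ht : MeasurableSet t) {M m A a b : ℝ≥0∞} (hM : ∀ x ∈ s, ∀ y ∈ t, k (x - y) ≤ M)
    (hA : ∫⁻ z, k z ∂μ ≤ A) (hfm : ∀ x ∈ sᶜ, f x ≤ m) (hgm : ∀ y ∈ tᶜ, g y ≤ m)
    (hfa : ∫⁻ x in s, f x ∂μ ≤ a) (hga : ∫⁻ y in t, g y ∂μ ≤ a)
    (hfb : (∫⁻ x in sᶜ, f x ^ (2 : ℝ) ∂μ) ^ (1 / 2 : ℝ) ≤ b)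
    (hgb : (∫⁻ y in tᶜ, g y ^ (2 : ℝ) ∂μ) ^ (1 / 2 : ℝ) ≤ b) :
    ∫⁻ x, ∫⁻ y, f x * k (x - y) * g y ∂μ ∂μ
      ≤ (M * a * a + m * A * a) + (m * A * a + A * (b * b)) := by
  have hsq {u : G → ℝ≥0∞} {r : Set G} (hr : MeasurableSet r) :
      ∫⁻ x, r.indicator u x ^ (2 : ℝ) ∂μ = ∫⁻ x in r, u x ^ (2 : ℝ) ∂μ := by
    rw [← lintegral_indicator hr]
    refine lintegral_congr fun x => ?_
    by_cases hx : x ∈ r <;> simp [hx]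
  have hle {u : G → ℝ≥0∞} {r : Set G} (hu : ∀ x ∈ r, u x ≤ m) (x : G) : r.indicator u x ≤ m := by
    by_cases hx : x ∈ r <;> simp [hx, hu]
  rw [lintegral_lintegral_eq_add_indicator μ hf hk hg hs ht]
  refine add_le_add (add_le_add ?_ ?_) (add_le_add ?_ ?_)
  · refine (lintegral_lintegral_mul_le_of_le μ (hf.indicator hs) (hg.indicator ht)
      (M := M) fun x y => ?_).trans ?_
    · by_cases hx : x ∈ s
      · by_cases hy : y ∈ t
        · simp only [hx, hy, indicator_of_mem]
          calc f x * k (x - y) * g y ≤ f x * M * g y := by gcongr; exact hM x hx y hy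
            _ = M * (f x * g y) := by ring
        · simp [hy]
      · simp [hx]
    · rw [lintegral_indicator hs, lintegral_indicator ht]
      gcongr
  · refine (lintegral_lintegral_mul_le_of_le_right μ (hf.indicator hs) hk (hle hgm)).trans ?_
    rw [lintegral_indicator hs]
    gcongr
  · refine (lintegral_lintegral_mul_le_of_le_left μ (hf.indicator hs.compl) hk
      (hg.indicator ht) (hle hfm)).trans ?_
    rw [lintegral_indicator ht]
    gcongr
  · refine (lintegral_lintegral_mul_le_L2 μ (hf.indicator hs.compl) hk
      (hg.indicator ht.compl)).trans ?_
    rw [hsq hs.compl, hsq ht.compl]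
    gcongr

lemma one_le_log_div {R L : ℝ} (hR : 0 < R) (hRL : 4 * R ≤ L) : 1 ≤ Real.log (L / R) := by
  have h4 : 4 ≤ L / R := by rwa [le_div_iff₀ hR]
  rw [Real.le_log_iff_exp_le (by linarith)]
  linarith [Real.exp_one_lt_d9]

lemma setLIntegral_closedBall_le_log {E : Type*} [NormedAddCommGroup E] [NormedSpace ℝ E]
    [FiniteDimensional ℝ E] [Nontrivial E] [MeasurableSpace E] [BorelSpace E] (μ : Measure E)
    [μ.IsAddHaarMeasure] {F : E → ℝ≥0∞} (hF : Measurable F) {R L : ℝ} (hR : 0 < R)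
    (hRL : 8 * R ≤ L) (z : E)
    (hdecay : ∀ x, 2 * R < ‖x - z‖ →
      F x ≤ ENNReal.ofReal (R ^ (-(finrank ℝ E : ℝ) / 2) * ‖x - z‖ ^ (-(finrank ℝ E : ℝ))))
    (hL2 : (∫⁻ x, F x ^ (2 : ℝ) ∂μ) ^ (1 / 2 : ℝ)
      ≤ ENNReal.ofReal (R ^ (-(finrank ℝ E : ℝ)))) :
    ∫⁻ x in closedBall z (L / 4), F x ∂μ
      ≤ ENNReal.ofReal ((√(2 ^ finrank ℝ E * μ.real (ball 0 1))
          + finrank ℝ E * μ.real (ball 0 1))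
          * R ^ (-(finrank ℝ E : ℝ) / 2) * Real.log (L / R)) := by
  have hlog : 1 ≤ Real.log (L / R) := one_le_log_div hR (by linarith)
  have hball : μ (closedBall z (2 * R)) ^ (1 / 2 : ℝ) = ENNReal.ofReal
      (√(2 ^ finrank ℝ E * μ.real (ball 0 1)) * R ^ ((finrank ℝ E : ℝ) / 2)) := by
    rw [← ofReal_measureReal measure_closedBall_lt_top.ne, Measure.addHaar_real_closedBall μ z (by positivity),
      ENNReal.ofReal_rpow_of_nonneg (by positivity) (by norm_num), ← Real.sqrt_eq_rpow, mul_pow,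
      mul_right_comm, Real.sqrt_mul (by positivity), Real.sqrt_eq_rpow (R ^ _),
      ← Real.rpow_natCast R, ← Real.rpow_mul hR.le]
    congr 3
    ring
  refine (setLIntegral_closedBall_le_of_decay μ hF (by positivity) (by positivity : 0 < 2 * R)
    (by linarith) z hdecay).trans ?_
  rw [hball]
  refine (add_le_add_left (mul_le_mul_right hL2 _) _).trans ?_
  have hlog' : 0 ≤ Real.log (L / 4 / (2 * R)) := by
    refine Real.log_nonneg ?_
    rw [le_div_iff₀ (by positivity)]
    linarith
  rw [← ENNReal.ofReal_mul (by positivity), ← ENNReal.ofReal_add (by positivity) (by positivity)]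
  refine ENNReal.ofReal_le_ofReal ?_
  have hpow : R ^ ((finrank ℝ E : ℝ) / 2) * R ^ (-(finrank ℝ E : ℝ))
      = R ^ (-(finrank ℝ E : ℝ) / 2) := by
    rw [← Real.rpow_add hR]
    congr 1
    ring
  have hle : Real.log (L / 4 / (2 * R)) ≤ Real.log (L / R) := by
    refine Real.log_le_log (by apply div_pos <;> linarith) ?_
    rw [div_div]
    gcongr <;> linarith
  rw [mul_assoc (√_), hpow, add_mul, add_mul]
  refine add_le_add (le_mul_of_one_le_right (by positivity) hlog) ?_
  calc R ^ (-(finrank ℝ E : ℝ) / 2)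
        * (finrank ℝ E * μ.real (ball 0 1) * Real.log (L / 4 / (2 * R)))
      ≤ R ^ (-(finrank ℝ E : ℝ) / 2)
        * (finrank ℝ E * μ.real (ball 0 1) * Real.log (L / R)) := by gcongr
    _ = _ := by ring

lemma rpow_neg_mul_rpow_neg_le {D α R L : ℝ} (hα : α ≤ D / 2) (hD : 0 ≤ D) (hR : 1 ≤ R)
    (hL : 1 ≤ L) : R ^ (-D) * L ^ (-D) ≤ R ^ (-D / 2) * L ^ (-D / 2 - α) := by
  gcongr <;> linarith

lemma rpow_neg_mul_log_le {D α R L : ℝ} (hD : 1 ≤ D) (hR : 1 ≤ R) (hRL : R ≤ L) :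
    L ^ (-(D + α)) * R ^ (-D) * Real.log (L / R) ≤ 2 * (R ^ (-D / 2) * L ^ (-D / 2 - α)) := by
  have hR0 : 0 < R := by linarith
  have hL0 : 0 < L := by linarith
  have hq : 1 ≤ L / R := by rwa [one_le_div hR0]
  have hlog : Real.log (L / R) ≤ 2 * (L ^ (D / 2) * R ^ (-(D / 2))) := by
    calc Real.log (L / R) ≤ (L / R) ^ (1 / 2 : ℝ) / (1 / 2) :=
          Real.log_le_rpow_div (by positivity) (by norm_num)
      _ ≤ (L / R) ^ (D / 2) / (1 / 2) := by
          gcongr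
      _ = _ := by
          rw [Real.div_rpow hL0.le hR0.le, Real.rpow_neg hR0.le]
          ring
  calc L ^ (-(D + α)) * R ^ (-D) * Real.log (L / R)
      ≤ L ^ (-(D + α)) * R ^ (-D) * (2 * (L ^ (D / 2) * R ^ (-(D / 2)))) := by gcongr
    _ = 2 * ((R ^ (-D) * R ^ (-(D / 2))) * (L ^ (-(D + α)) * L ^ (D / 2))) := by ring
    _ = 2 * (R ^ (-D + -(D / 2)) * L ^ (-(D + α) + D / 2)) := by
        rw [Real.rpow_add hR0, Real.rpow_add hL0]
    _ ≤ 2 * (R ^ (-D / 2) * L ^ (-D / 2 - α)) := by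
        gcongr <;> linarith

lemma rpow_neg_sq_le {D α R L : ℝ} (hα0 : 0 ≤ α) (hα : α ≤ D / 2) (hR : 1 ≤ R) (hL0 : 0 < L)
    (hL : L ≤ 8 * R) :
    R ^ (-D) * R ^ (-D) ≤ 8 ^ (D / 2 + α) * (R ^ (-D / 2) * L ^ (-D / 2 - α)) := by
  have hR0 : 0 < R := by linarith
  calc R ^ (-D) * R ^ (-D) = R ^ (-D / 2) * R ^ (-(3 * D / 2)) := by
        rw [← Real.rpow_add hR0, ← Real.rpow_add hR0]
        congr 1
        ring
    _ ≤ R ^ (-D / 2) * R ^ (-D / 2 - α) := by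
        gcongr
        linarith
    _ ≤ R ^ (-D / 2) * (L / 8) ^ (-D / 2 - α) := by
        gcongr R ^ (-D / 2) * ?_
        exact Real.rpow_le_rpow_of_nonpos (by positivity) (by linarith) (by linarith)
    _ = 8 ^ (D / 2 + α) * (R ^ (-D / 2) * L ^ (-D / 2 - α)) := by
        rw [Real.div_rpow hL0.le (by norm_num), show D / 2 + α = -(-D / 2 - α) by ring,
          Real.rpow_neg (by norm_num : (0 : ℝ) ≤ 8)]
        ring

/-- Central decorrelation computation: if H(x) = ⟨|∇h(x)|⁴⟩^{1/4} satisfies the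
far-field bound H(x) ≤ R^{-d/2}|x|^{-d} for |x| > 2R and the global bound
(∫ H²)^{1/2} ≤ R^{-d}, with the translated analogues for H' centered at Le, then
∫∫ H(x) |c(x-y)| H'(y) dy dx ≤ C R^{-d/2} L^{-d/2-α} log(L/R). -/
theorem stmt17 (d : ℕ) (hd : 1 ≤ d) (α C₀ : ℝ) (hα : 0 < α) (hα2 : α ≤ (d : ℝ) / 2)
    (hC₀ : 0 ≤ C₀) :
    ∃ C > 0, ∀ (R L : ℝ) (e : EuclideanSpace ℝ (Fin d))
      (c H H' : EuclideanSpace ℝ (Fin d) → ℝ),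
      1 ≤ R → 4 * R ≤ L → ‖e‖ = 1 →
      Measurable c → Measurable H → Measurable H' →
      (∀ x, 0 ≤ H x) → (∀ y, 0 ≤ H' y) →
      (∀ z, |c z| ≤ C₀ * (1 + ‖z‖) ^ (-((d : ℝ) + α))) →
      (∀ x, 2 * R < ‖x‖ → H x ≤ R ^ (-(d : ℝ) / 2) * ‖x‖ ^ (-(d : ℝ))) →
      (∀ y, 2 * R < ‖y - L • e‖ → H' y ≤ R ^ (-(d : ℝ) / 2) * ‖y - L • e‖ ^ (-(d : ℝ))) →
      (∫⁻ x, ENNReal.ofReal (H x ^ 2)) ^ ((1 : ℝ) / 2) ≤ ENNReal.ofReal (R ^ (-(d : ℝ))) →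
      (∫⁻ y, ENNReal.ofReal (H' y ^ 2)) ^ ((1 : ℝ) / 2) ≤ ENNReal.ofReal (R ^ (-(d : ℝ))) →
      ∫⁻ x, ∫⁻ y, ENNReal.ofReal (H x * |c (x - y)| * H' y)
        ≤ ENNReal.ofReal
            (C * R ^ (-(d : ℝ) / 2) * L ^ (-(d : ℝ) / 2 - α) * Real.log (L / R)) := by
  have hd' : (1 : ℝ) ≤ d := by exact_mod_cast hd
  have : Nonempty (Fin d) := ⟨⟨0, hd⟩⟩
  set V : ℝ := volume.real (ball (0 : EuclideanSpace ℝ (Fin d)) 1)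
  set I : ℝ := (∫⁻ z : EuclideanSpace ℝ (Fin d),
    ENNReal.ofReal ((1 + ‖z‖) ^ (-((d : ℝ) + α)))).toReal with hI
  have hV0 : 0 ≤ V := measureReal_nonneg
  have hI0 : 0 ≤ I := ENNReal.toReal_nonneg
  set A : ℝ := C₀ * I with hA
  set K₁ : ℝ := √(2 ^ d * V) + d * V with hK₁
  set K₂ : ℝ := √V * 4 ^ ((d : ℝ) / 2) with hK₂
  have hA0 : 0 ≤ A := mul_nonneg hC₀ hI0
  have hK₁0 : 0 ≤ K₁ := by positivity
  have hK₂0 : 0 ≤ K₂ := by positivity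
  refine ⟨A * 8 ^ ((d : ℝ) / 2 + α) + 2 * (C₀ * 2 ^ ((d : ℝ) + α) * K₁ ^ 2)
    + 2 * (4 ^ (d : ℝ) * A * K₁) + A * K₂ ^ 2 + 1, by positivity, ?_⟩
  intro R L e c H H' hR hRL he hc hH hH' hH0 hH'0 hck hHdecay hH'decay hH2 hH'2
  have hR0 : 0 < R := by linarith
  have hL0 : 0 < L := by linarith
  set Λ := Real.log (L / R)
  have hΛ1 : 1 ≤ Λ := one_le_log_div hR0 hRL
  set S := R ^ (-(d : ℝ) / 2) * L ^ (-(d : ℝ) / 2 - α) with hS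
  have hS0 : 0 ≤ S := by positivity
  set F : EuclideanSpace ℝ (Fin d) → ℝ≥0∞ := fun x => ENNReal.ofReal (H x) with hF
  set F' : EuclideanSpace ℝ (Fin d) → ℝ≥0∞ := fun x => ENNReal.ofReal (H' x) with hF'
  set k : EuclideanSpace ℝ (Fin d) → ℝ≥0∞ := fun x => ENNReal.ofReal |c x|
  have hFm : Measurable F := by fun_prop
  have hF'm : Measurable F' := by fun_prop
  have hkm : Measurable k := hc.abs.ennreal_ofReal
  have hprod : ∫⁻ x, ∫⁻ y, ENNReal.ofReal (H x * |c (x - y)| * H' y)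
      = ∫⁻ x, ∫⁻ y, F x * k (x - y) * F' y := by
    refine lintegral_congr fun x => lintegral_congr fun y => ?_
    rw [ENNReal.ofReal_mul (mul_nonneg (hH0 x) (abs_nonneg _)), ENNReal.ofReal_mul (hH0 x)]
  have hF2 : (∫⁻ x, F x ^ (2 : ℝ)) ^ (1 / 2 : ℝ) ≤ ENNReal.ofReal (R ^ (-(d : ℝ))) := by
    simpa [hF, ENNReal.ofReal_pow (hH0 _)] using hH2
  have hF'2 : (∫⁻ x, F' x ^ (2 : ℝ)) ^ (1 / 2 : ℝ) ≤ ENNReal.ofReal (R ^ (-(d : ℝ))) := by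
    simpa [hF', ENNReal.ofReal_pow (hH'0 _)] using hH'2
  have hkA : ∫⁻ z, k z ≤ ENNReal.ofReal A := by
    have hfin : ∫⁻ z : EuclideanSpace ℝ (Fin d),
        ENNReal.ofReal ((1 + ‖z‖) ^ (-((d : ℝ) + α))) < ∞ :=
      finite_integral_one_add_norm (by simpa using hα)
    rw [hA, ENNReal.ofReal_mul hC₀, hI, ENNReal.ofReal_toReal hfin.ne,
      ← lintegral_const_mul' _ _ ENNReal.ofReal_ne_top]
    refine lintegral_mono fun z => ?_
    rw [← ENNReal.ofReal_mul hC₀]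
    exact ENNReal.ofReal_le_ofReal (hck z)
  rw [hprod]
  rcases le_total L (8 * R) with hL | hL
  · refine (lintegral_lintegral_mul_le_L2 volume hFm hkm hF'm).trans
      ((mul_le_mul' hkA (mul_le_mul' hF2 hF'2)).trans ?_)
    rw [← ENNReal.ofReal_mul (by positivity), ← ENNReal.ofReal_mul (by positivity)]
    refine ENNReal.ofReal_le_ofReal ?_
    calc A * (R ^ (-(d : ℝ)) * R ^ (-(d : ℝ))) ≤ A * (8 ^ ((d : ℝ) / 2 + α) * S) :=
          mul_le_mul_of_nonneg_left (rpow_neg_sq_le hα.le hα2 hR hL0 hL) hA0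
      _ ≤ A * (8 ^ ((d : ℝ) / 2 + α) * S) * Λ :=
          le_mul_of_one_le_right (by positivity) hΛ1
      _ = (A * 8 ^ ((d : ℝ) / 2 + α)) * (S * Λ) := by ring
      _ ≤ (A * 8 ^ ((d : ℝ) / 2 + α) + 2 * (C₀ * 2 ^ ((d : ℝ) + α) * K₁ ^ 2)
            + 2 * (4 ^ (d : ℝ) * A * K₁) + A * K₂ ^ 2 + 1) * (S * Λ) := by
          refine mul_le_mul_of_nonneg_right ?_ (by positivity)
          have : 0 ≤ 2 * (C₀ * 2 ^ ((d : ℝ) + α) * K₁ ^ 2)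
            + 2 * (4 ^ (d : ℝ) * A * K₁) + A * K₂ ^ 2 + 1 := by positivity
          linarith
      _ = _ := by rw [hS]; ring
  · have hfr : (finrank ℝ (EuclideanSpace ℝ (Fin d))) = d := by simp
    have hFdecay : ∀ x, 2 * R < ‖x - 0‖ →
        F x ≤ ENNReal.ofReal (R ^ (-(d : ℝ) / 2) * ‖x - 0‖ ^ (-(d : ℝ))) := by
      intro x hx
      rw [sub_zero] at hx ⊢
      exact ENNReal.ofReal_le_ofReal (hHdecay x hx)
    have hF'decay : ∀ x, 2 * R < ‖x - L • e‖ →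
        F' x ≤ ENNReal.ofReal (R ^ (-(d : ℝ) / 2) * ‖x - L • e‖ ^ (-(d : ℝ))) :=
      fun x hx => ENNReal.ofReal_le_ofReal (hH'decay x hx)
    have near {f : EuclideanSpace ℝ (Fin d) → ℝ≥0∞} (hf : Measurable f)
        (z : EuclideanSpace ℝ (Fin d))
        (hfdecay : ∀ x, 2 * R < ‖x - z‖ →
          f x ≤ ENNReal.ofReal (R ^ (-(d : ℝ) / 2) * ‖x - z‖ ^ (-(d : ℝ))))
        (hf2 : (∫⁻ x, f x ^ (2 : ℝ)) ^ (1 / 2 : ℝ) ≤ ENNReal.ofReal (R ^ (-(d : ℝ)))) :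
        ∫⁻ x in closedBall z (L / 4), f x
          ≤ ENNReal.ofReal (K₁ * R ^ (-(d : ℝ) / 2) * Λ) := by
      have h := setLIntegral_closedBall_le_log volume hf hR0 hL z
        (by rwa [hfr]) (by rwa [hfr])
      rwa [hfr] at h
    have far {f : EuclideanSpace ℝ (Fin d) → ℝ≥0∞} (z : EuclideanSpace ℝ (Fin d))
        (hfdecay : ∀ x, 2 * R < ‖x - z‖ →
          f x ≤ ENNReal.ofReal (R ^ (-(d : ℝ) / 2) * ‖x - z‖ ^ (-(d : ℝ)))) :
        (∫⁻ x in (closedBall z (L / 4))ᶜ, f x ^ (2 : ℝ)) ^ (1 / 2 : ℝ)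
          ≤ ENNReal.ofReal (K₂ * (R ^ (-(d : ℝ) / 2) * L ^ (-(d : ℝ) / 2))) := by
      have h := setLIntegral_sq_compl_closedBall_le_of_decay volume (F := f)
        (K := R ^ (-(d : ℝ) / 2)) (b := L / 4) (by positivity) (by positivity) z
        (by rw [hfr]; exact fun x hx => hfdecay x (by linarith))
      rw [hfr] at h
      refine h.trans_eq ?_
      rw [hK₂, Real.div_rpow hL0.le (by norm_num), neg_div,
        Real.rpow_neg zero_le_four, div_inv_eq_mul]
      congr 1
      ring
    have sup {f : EuclideanSpace ℝ (Fin d) → ℝ≥0∞} (z : EuclideanSpace ℝ (Fin d))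
        (hfdecay : ∀ x, 2 * R < ‖x - z‖ →
          f x ≤ ENNReal.ofReal (R ^ (-(d : ℝ) / 2) * ‖x - z‖ ^ (-(d : ℝ)))) :
        ∀ x ∈ (closedBall z (L / 4))ᶜ,
          f x ≤ ENNReal.ofReal (4 ^ (d : ℝ) * (R ^ (-(d : ℝ) / 2) * L ^ (-(d : ℝ)))) := by
      intro x hx
      have hx' : L / 4 < ‖x - z‖ := by simpa [dist_eq_norm] using hx
      refine (hfdecay x (by linarith)).trans (ENNReal.ofReal_le_ofReal ?_)
      calc R ^ (-(d : ℝ) / 2) * ‖x - z‖ ^ (-(d : ℝ))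
          ≤ R ^ (-(d : ℝ) / 2) * (L / 4) ^ (-(d : ℝ)) := by
            gcongr R ^ (-(d : ℝ) / 2) * ?_
            exact Real.rpow_le_rpow_of_nonpos (by positivity) hx'.le (by linarith)
        _ = _ := by
            rw [Real.div_rpow hL0.le (by norm_num), Real.rpow_neg zero_le_four]
            field_simp
    have hM : ∀ x ∈ closedBall (0 : EuclideanSpace ℝ (Fin d)) (L / 4),
        ∀ y ∈ closedBall (L • e) (L / 4),
          k (x - y) ≤ ENNReal.ofReal (C₀ * 2 ^ ((d : ℝ) + α) * L ^ (-((d : ℝ) + α))) := by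
      intro x hx y hy
      rw [mem_closedBall, dist_eq_norm] at hx hy
      have hLe : ‖L • e‖ = L := by rw [norm_smul, he, mul_one, Real.norm_of_nonneg hL0.le]
      have hxy : L / 2 ≤ 1 + ‖x - y‖ := by
        have h1 : L • e = (x - 0) - (x - y) - (y - L • e) := by abel
        have h2 := (norm_sub_le ((x - 0) - (x - y)) (y - L • e)).trans
          (add_le_add_left (norm_sub_le _ _) _)
        rw [← h1, hLe] at h2
        linarith
      refine ENNReal.ofReal_le_ofReal ((hck _).trans ?_)
      calc C₀ * (1 + ‖x - y‖) ^ (-((d : ℝ) + α)) ≤ C₀ * (L / 2) ^ (-((d : ℝ) + α)) := by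
            gcongr C₀ * ?_
            exact Real.rpow_le_rpow_of_nonpos (by positivity) hxy (by linarith)
        _ = _ := by
            rw [Real.div_rpow hL0.le (by norm_num), Real.rpow_neg zero_le_two]
            field_simp
    refine (lintegral_lintegral_mul_le_of_near_far volume hFm hkm hF'm measurableSet_closedBall
      measurableSet_closedBall hM hkA (sup 0 hFdecay) (sup (L • e) hF'decay)
      (near hFm 0 hFdecay hF2) (near hF'm (L • e) hF'decay hF'2) (far 0 hFdecay)
      (far (L • e) hF'decay)).trans ?_
    have hΛ0 : 0 ≤ Λ := by linarith
    simp (discharger := positivity) only [← ENNReal.ofReal_mul, ← ENNReal.ofReal_add]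
    refine ENNReal.ofReal_le_ofReal ?_
    have hRR : R ^ (-(d : ℝ) / 2) * R ^ (-(d : ℝ) / 2) = R ^ (-(d : ℝ)) := by
      rw [← Real.rpow_add hR0]
      congr 1
      ring
    have hLL : L ^ (-(d : ℝ) / 2) * L ^ (-(d : ℝ) / 2) = L ^ (-(d : ℝ)) := by
      rw [← Real.rpow_add hL0]
      congr 1
      ring
    have hfar : R ^ (-(d : ℝ)) * L ^ (-(d : ℝ)) ≤ S :=
      rpow_neg_mul_rpow_neg_le hα2 (by linarith) hR (by linarith)
    have hnear : L ^ (-((d : ℝ) + α)) * R ^ (-(d : ℝ)) * Λ ≤ 2 * S :=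
      rpow_neg_mul_log_le hd' hR (by linarith)
    have hfarΛ : R ^ (-(d : ℝ)) * L ^ (-(d : ℝ)) ≤ S * Λ :=
      hfar.trans (le_mul_of_one_le_right hS0 hΛ1)
    calc _ = C₀ * 2 ^ ((d : ℝ) + α) * K₁ ^ 2 *
            (L ^ (-((d : ℝ) + α)) * (R ^ (-(d : ℝ) / 2) * R ^ (-(d : ℝ) / 2)) * Λ * Λ)
          + 2 * (4 ^ (d : ℝ) * A * K₁) *
            (R ^ (-(d : ℝ) / 2) * R ^ (-(d : ℝ) / 2) * L ^ (-(d : ℝ)) * Λ)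
          + A * K₂ ^ 2 * (R ^ (-(d : ℝ) / 2) * R ^ (-(d : ℝ) / 2) *
            (L ^ (-(d : ℝ) / 2) * L ^ (-(d : ℝ) / 2))) := by ring
      _ ≤ C₀ * 2 ^ ((d : ℝ) + α) * K₁ ^ 2 * (2 * S * Λ)
          + 2 * (4 ^ (d : ℝ) * A * K₁) * (S * Λ) + A * K₂ ^ 2 * (S * Λ) := by
          rw [hRR, hLL]
          gcongr
      _ ≤ (A * 8 ^ ((d : ℝ) / 2 + α) + 2 * (C₀ * 2 ^ ((d : ℝ) + α) * K₁ ^ 2)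
            + 2 * (4 ^ (d : ℝ) * A * K₁) + A * K₂ ^ 2 + 1) * (S * Λ) := by
          have : 0 ≤ (A * 8 ^ ((d : ℝ) / 2 + α) + 1) * (S * Λ) := by positivity
          linarith
      _ = _ := by rw [hS]; ring
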